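/- Common lower bound for the two compound-state χ-quantities (eq. (3.63)): χ{P_f, ε_i} ≥ S(γ_{if} | η ⊗ η_f) and χ{p, τ_f} ≥ S(γ_{if} | η ⊗ η_f), where ε_i(ω) := Σ_{α : p(α,ω) > 0} P_{i|f}(α|ω)·ρ_α, τ_f(α) := Σ_{ω : P_f(ω) > 0} P(ω|α)·ρ_f(ω), and γ_{if} := Σ_{ω : P_f(ω) > 0} P_f(ω)·(ε_i(ω) ⊗ ρ_f(ω)) is a density matrix on ℂ^n ⊗ ℂ^m satisfying ker(η ⊗ η_f) ⊆ ker γ_{if}. -/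

import Mathlib

open Matrix BigOperators
open scoped Kronecker ComplexOrder

noncomputable section

/-- A density matrix: positive semidefinite with unit trace. -/
def IsDensityMatrix {ι : Type*} [Fintype ι] (ρ : Matrix ι ι ℂ) : Prop :=
  ρ.PosSemidef ∧ ρ.trace = 1

/-- von Neumann entropy (natural logarithm), via the eigenvalues;
junk value `0` if the matrix is not Hermitian. -/
noncomputable def vnEntropy {ι : Type*} [Fintype ι] [DecidableEq ι]
    (ρ : Matrix ι ι ℂ) : ℝ :=
  if h : ρ.IsHermitian then -∑ i, h.eigenvalues i * Real.log (h.eigenvalues i) else 0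

/-- Quantum relative entropy `S(σ|τ)` (natural logarithm), computed in an orthonormal
eigenbasis of `τ`; junk value `0` if `σ` or `τ` is not Hermitian. -/
noncomputable def relEnt {ι : Type*} [Fintype ι] [DecidableEq ι]
    (σ τ : Matrix ι ι ℂ) : ℝ :=
  if h : σ.IsHermitian ∧ τ.IsHermitian then
    (∑ i, h.1.eigenvalues i * Real.log (h.1.eigenvalues i))
      - ∑ j, (if 0 < h.2.eigenvalues j then
          Real.log (h.2.eigenvalues j) *
            ((star (fun i => h.2.eigenvectorBasis j i)) ⬝ᵥ
              σ.mulVec (fun i => h.2.eigenvectorBasis j i)).re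
        else 0)
  else 0

/-- Holevo χ-quantity of an ensemble of states, relative to its barycenter. -/
noncomputable def holevoChi {ι B : Type*} [Fintype ι] [DecidableEq ι] [Fintype B]
    (q : B → ℝ) (τ : B → Matrix ι ι ℂ) : ℝ :=
  ∑ β, if 0 < q β then q β * relEnt (τ β) (∑ γ, q γ • τ γ) else 0

/-- The action of an instrument in Kraus form: `I_ω(ρ) = ∑ k, V ω k * ρ * (V ω k)ᴴ`. -/
noncomputable def instAct {n m : ℕ} {Ω K : Type*} [Fintype K]
    (V : Ω → K → Matrix (Fin m) (Fin n) ℂ) (ω : Ω)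
    (ρ : Matrix (Fin n) (Fin n) ℂ) : Matrix (Fin m) (Fin m) ℂ :=
  ∑ k, V ω k * ρ * (V ω k)ᴴ

/-- The POVM associated with an instrument in Kraus form: `E_ω = ∑ k, (V ω k)ᴴ * V ω k`. -/
noncomputable def povm {n m : ℕ} {Ω K : Type*} [Fintype K]
    (V : Ω → K → Matrix (Fin m) (Fin n) ℂ) (ω : Ω) : Matrix (Fin n) (Fin n) ℂ :=
  ∑ k, (V ω k)ᴴ * V ω k

/-- Outcome probability `Tr(E_ω ρ)`. -/
noncomputable def probOut {n m : ℕ} {Ω K : Type*} [Fintype K]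
    (V : Ω → K → Matrix (Fin m) (Fin n) ℂ) (ρ : Matrix (Fin n) (Fin n) ℂ) (ω : Ω) : ℝ :=
  ((povm V ω * ρ).trace).re

/-- The a posteriori state `π_ρ(ω) = I_ω(ρ)/Tr(I_ω(ρ))` (junk if the trace vanishes). -/
noncomputable def post {n m : ℕ} {Ω K : Type*} [Fintype K]
    (V : Ω → K → Matrix (Fin m) (Fin n) ℂ) (ω : Ω)
    (ρ : Matrix (Fin n) (Fin n) ℂ) : Matrix (Fin m) (Fin m) ℂ :=
  (((instAct V ω ρ).trace.re)⁻¹ : ℝ) • instAct V ω ρ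

/-- The classical (Shannon) input/output mutual information of the ensemble `(p, ρ)`
measured with the POVM of the instrument `V`. -/
noncomputable def Ic {n m : ℕ} {A Ω K : Type*} [Fintype A] [Fintype Ω] [Fintype K]
    (p : A → ℝ) (ρ : A → Matrix (Fin n) (Fin n) ℂ)
    (V : Ω → K → Matrix (Fin m) (Fin n) ℂ) : ℝ :=
  ∑ α, ∑ ω,
    if 0 < p α * probOut V (ρ α) ω then
      p α * probOut V (ρ α) ω *
        Real.log ((p α * probOut V (ρ α) ω) /
          (p α * probOut V (∑ β, p β • ρ β) ω))
    else 0

/-- Quantum information gain of the instrument `V` at the state `ρ`. -/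
noncomputable def infoGain {n m : ℕ} {Ω K : Type*} [Fintype Ω] [Fintype K]
    (V : Ω → K → Matrix (Fin m) (Fin n) ℂ) (ρ : Matrix (Fin n) (Fin n) ℂ) : ℝ :=
  vnEntropy ρ - ∑ ω, if 0 < (instAct V ω ρ).trace.re then
    (instAct V ω ρ).trace.re * vnEntropy (post V ω ρ) else 0


/-- The integrand of the integral representation of the relative entropy, in terms of the
spectra `a`, `b` and the overlap matrix `G` of two eigenbases. -/
def spectralQuad {ι : Type*} [Fintype ι] (a b : ι → ℝ) (G : Matrix ι ι ℂ) (t : ℝ) : ℝ :=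
  ∑ i, ∑ j, Complex.normSq (G i j) * ((a i - b j) ^ 2 / (t * a i + (1 - t) * b j))

/-- The functional, jointly linear in `(ρ, σ)`, whose supremum over `X` is `spectralQuad`. -/
def varFun {ι : Type*} [Fintype ι] (t : ℝ) (ρ σ X : Matrix ι ι ℂ) : ℝ :=
  2 * ((ρ * X).trace - (σ * X).trace).re - t * (ρ * X * Xᴴ).trace.re
    - (1 - t) * (σ * Xᴴ * X).trace.re

section Scalar

lemma hasDerivAt_log_segment (a b t : ℝ) (h : b + t * (a - b) ≠ 0) :
    HasDerivAt (fun t => a * Real.log (b + t * (a - b)) - (a - b) * t)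
      ((1 - t) * ((a - b) ^ 2 / (t * a + (1 - t) * b))) t := by
  have h' : t * a + (1 - t) * b ≠ 0 := by convert h using 1; ring
  have h1 : HasDerivAt (fun t : ℝ => b + t * (a - b)) (a - b) t := by
    simpa using ((hasDerivAt_id t).mul_const (a - b)).const_add b
  have h2 := ((h1.log h).const_mul a).sub ((hasDerivAt_id t).const_mul (a - b))
  refine h2.congr_deriv ?_
  rw [show b + t * (a - b) = t * a + (1 - t) * b by ring]
  generalize hD : t * a + (1 - t) * b = D at h'
  field_simp
  rw [← hD]
  ring

/-- Integral representation of `a * log (a / b) - a + b`. -/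
lemma integral_log_quotient {a b : ℝ} (ha : 0 ≤ a) (hb : 0 ≤ b) (hab : b = 0 → a = 0) :
    IntervalIntegrable (fun t => (1 - t) * ((a - b) ^ 2 / (t * a + (1 - t) * b)))
      MeasureTheory.volume 0 1 ∧
    ∫ t in (0 : ℝ)..1, (1 - t) * ((a - b) ^ 2 / (t * a + (1 - t) * b)) =
      a * Real.log a - a * Real.log b - a + b := by
  rcases hb.eq_or_lt with hb | hb
  · subst hb
    simp [hab rfl]
  rcases ha.eq_or_lt with ha | ha
  · subst ha
    have h : Set.EqOn (fun t : ℝ => (1 - t) * ((0 - b) ^ 2 / (t * 0 + (1 - t) * b)))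
        (fun _ => b) (Set.uIoo 0 1) := by
      intro t ht
      rw [Set.uIoo_of_le zero_le_one] at ht
      have : 1 - t ≠ 0 := by linarith [ht.2]
      simp only
      field_simp
      ring
    constructor
    · exact (intervalIntegrable_congr_uIoo h).2 (by simp)
    · rw [intervalIntegral.integral_congr_uIoo h]
      simp
  · have hpos : ∀ t ∈ Set.uIcc (0 : ℝ) 1, 0 < t * a + (1 - t) * b := by
      intro t ht
      rw [Set.uIcc_of_le zero_le_one] at ht
      rcases ht.1.eq_or_lt with h | h
      · subst h; simpa using hb
      · nlinarith [mul_pos h ha, mul_nonneg (sub_nonneg.2 ht.2) hb.le]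
    have hint : IntervalIntegrable
        (fun t => (1 - t) * ((a - b) ^ 2 / (t * a + (1 - t) * b)))
        MeasureTheory.volume 0 1 := by
      apply ContinuousOn.intervalIntegrable
      refine ContinuousOn.mul (by fun_prop) (ContinuousOn.div (by fun_prop) (by fun_prop) ?_)
      exact fun t ht => (hpos t ht).ne'
    refine ⟨hint, ?_⟩
    rw [intervalIntegral.integral_eq_sub_of_hasDerivAt
      (fun t ht => hasDerivAt_log_segment a b t ?_) hint]
    · simp
      ring
    · convert (hpos t ht).ne' using 1
      ring

/-- The weighted form of `integral_log_quotient`: a vanishing weight removes the support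
condition. -/
lemma integral_weighted_log_quotient {a b w : ℝ} (ha : 0 ≤ a) (hb : 0 ≤ b)
    (hab : b = 0 → w * a = 0) :
    IntervalIntegrable (fun t => (1 - t) * (w * ((a - b) ^ 2 / (t * a + (1 - t) * b))))
      MeasureTheory.volume 0 1 ∧
    ∫ t in (0 : ℝ)..1, (1 - t) * (w * ((a - b) ^ 2 / (t * a + (1 - t) * b))) =
      w * (a * Real.log a - a * Real.log b - a + b) := by
  rcases eq_or_ne w 0 with hw | hw
  · simp [hw]
  obtain ⟨h1, h2⟩ := integral_log_quotient ha hb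
    (fun h => (mul_eq_zero.1 (hab h)).resolve_left hw)
  simp_rw [mul_left_comm _ w]
  exact ⟨h1.const_mul w, by rw [intervalIntegral.integral_const_mul, h2]⟩

/-- Completing the square. -/
lemma completed_square_le {c d : ℝ} (g y : ℂ) (hd : 0 ≤ d) (hc : d = 0 → c = 0) :
    2 * (c * (star g * y).re) - d * Complex.normSq y ≤ Complex.normSq g * (c ^ 2 / d) := by
  rcases hd.eq_or_lt with hd | hd
  · simp [← hd, hc hd.symm]
  rw [mul_div_assoc', le_div_iff₀ hd]
  simp only [Complex.normSq_apply, Complex.mul_re, RCLike.star_def, Complex.conj_re,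
    Complex.conj_im]
  nlinarith [sq_nonneg (d * y.re - c * g.re), sq_nonneg (d * y.im - c * g.im)]

lemma completed_square_eq {c d : ℝ} (g : ℂ) :
    2 * (c * (star g * (((c / d : ℝ) : ℂ) * g)).re) -
      d * Complex.normSq (((c / d : ℝ) : ℂ) * g) = Complex.normSq g * (c ^ 2 / d) := by
  rcases eq_or_ne d 0 with hd | hd
  · simp [hd]
  simp only [Complex.normSq_apply, Complex.mul_re, RCLike.star_def, Complex.conj_re,
    Complex.conj_im, Complex.ofReal_re, Complex.ofReal_im, Complex.mul_im]
  field_simp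
  ring

end Scalar

section Spectral

variable {ι : Type*} [Fintype ι] [DecidableEq ι]

lemma isHermitian_eq_diag {ρ : Matrix ι ι ℂ} (h : ρ.IsHermitian) :
    ρ = (h.eigenvectorUnitary : Matrix ι ι ℂ) * diagonal (fun i => (h.eigenvalues i : ℂ)) *
      (h.eigenvectorUnitary : Matrix ι ι ℂ)ᴴ :=
  h.spectral_theorem

lemma eigenvectorUnitary_conjTranspose_mul {ρ : Matrix ι ι ℂ} (h : ρ.IsHermitian) :
    (h.eigenvectorUnitary : Matrix ι ι ℂ)ᴴ * (h.eigenvectorUnitary : Matrix ι ι ℂ) = 1 :=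
  Unitary.coe_star_mul_self h.eigenvectorUnitary

lemma eigenvectorUnitary_mul_conjTranspose {ρ : Matrix ι ι ℂ} (h : ρ.IsHermitian) :
    (h.eigenvectorUnitary : Matrix ι ι ℂ) * (h.eigenvectorUnitary : Matrix ι ι ℂ)ᴴ = 1 :=
  Unitary.coe_mul_star_self h.eigenvectorUnitary

/-- The matrix of overlaps of two eigenbases. -/
def overlap {ρ σ : Matrix ι ι ℂ} (hρ : ρ.IsHermitian) (hσ : σ.IsHermitian) : Matrix ι ι ℂ :=
  (hρ.eigenvectorUnitary : Matrix ι ι ℂ)ᴴ * (hσ.eigenvectorUnitary : Matrix ι ι ℂ)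

lemma sum_normSq_row {G : Matrix ι ι ℂ} (h : G * Gᴴ = 1) (i : ι) :
    ∑ j, Complex.normSq (G i j) = 1 := by
  have := congrFun (congrFun h i) i
  simp only [Matrix.mul_apply, conjTranspose_apply, one_apply_eq, RCLike.star_def,
    Complex.mul_conj] at this
  exact_mod_cast this

lemma sum_normSq_col {G : Matrix ι ι ℂ} (h : Gᴴ * G = 1) (j : ι) :
    ∑ i, Complex.normSq (G i j) = 1 := by
  have := congrFun (congrFun h j) j
  simp only [Matrix.mul_apply, conjTranspose_apply, one_apply_eq, RCLike.star_def,
    mul_comm, Complex.mul_conj] at this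
  exact_mod_cast this

lemma overlap_mul_conjTranspose {ρ σ : Matrix ι ι ℂ} (hρ : ρ.IsHermitian)
    (hσ : σ.IsHermitian) : overlap hρ hσ * (overlap hρ hσ)ᴴ = 1 := by
  simp only [overlap, conjTranspose_mul, conjTranspose_conjTranspose]
  rw [Matrix.mul_assoc, ← Matrix.mul_assoc _ _ (hρ.eigenvectorUnitary : Matrix ι ι ℂ),
    eigenvectorUnitary_mul_conjTranspose, Matrix.one_mul, eigenvectorUnitary_conjTranspose_mul]

lemma overlap_conjTranspose_mul {ρ σ : Matrix ι ι ℂ} (hρ : ρ.IsHermitian)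
    (hσ : σ.IsHermitian) : (overlap hρ hσ)ᴴ * overlap hρ hσ = 1 :=
  mul_eq_one_comm.1 (overlap_mul_conjTranspose hρ hσ)

lemma varFun_diag (t : ℝ) (a b : ι → ℝ) {U V : Matrix ι ι ℂ} (Y : Matrix ι ι ℂ)
    (hU : Uᴴ * U = 1) (hV : Vᴴ * V = 1) :
    varFun t (U * diagonal (fun i => (a i : ℂ)) * Uᴴ) (V * diagonal (fun i => (b i : ℂ)) * Vᴴ)
      (U * Y * Vᴴ) =
    ∑ i, ∑ j, (2 * ((a i - b j) * (star ((Uᴴ * V) i j) * Y i j).re) -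
      (t * a i + (1 - t) * b j) * Complex.normSq (Y i j)) := by
  set D := diagonal (fun i => (a i : ℂ))
  set E := diagonal (fun i => (b i : ℂ))
  have e1 : (U * D * Uᴴ * (U * Y * Vᴴ)).trace = (D * Y * (Uᴴ * V)ᴴ).trace := by
    rw [show U * D * Uᴴ * (U * Y * Vᴴ) = U * (D * (Uᴴ * U) * Y * Vᴴ) by
      simp only [Matrix.mul_assoc], hU, Matrix.trace_mul_comm]
    simp [Matrix.mul_assoc]
  have e2 : (V * E * Vᴴ * (U * Y * Vᴴ)).trace = (Y * E * (Uᴴ * V)ᴴ).trace := by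
    rw [show V * E * Vᴴ * (U * Y * Vᴴ) = (V * E * Vᴴ * U) * (Y * Vᴴ) by
      simp only [Matrix.mul_assoc], Matrix.trace_mul_comm,
      show Y * Vᴴ * (V * E * Vᴴ * U) = Y * (Vᴴ * V) * E * Vᴴ * U by
      simp only [Matrix.mul_assoc], hV]
    simp [Matrix.mul_assoc]
  have e3 : (U * D * Uᴴ * (U * Y * Vᴴ) * (U * Y * Vᴴ)ᴴ).trace = (D * Y * Yᴴ).trace := by
    rw [show U * D * Uᴴ * (U * Y * Vᴴ) * (U * Y * Vᴴ)ᴴ =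
        U * (D * (Uᴴ * U) * Y * (Vᴴ * V) * Yᴴ * Uᴴ) by
      simp only [Matrix.mul_assoc, conjTranspose_mul, conjTranspose_conjTranspose],
      Matrix.trace_mul_comm, hU, hV,
      show D * 1 * Y * 1 * Yᴴ * Uᴴ * U = D * Y * Yᴴ * (Uᴴ * U) by
      simp only [Matrix.mul_assoc, Matrix.one_mul], hU, Matrix.mul_one]
  have e4 : (V * E * Vᴴ * (U * Y * Vᴴ)ᴴ * (U * Y * Vᴴ)).trace = (E * Yᴴ * Y).trace := by
    rw [show V * E * Vᴴ * (U * Y * Vᴴ)ᴴ * (U * Y * Vᴴ) =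
        V * (E * (Vᴴ * V) * Yᴴ * (Uᴴ * U) * Y * Vᴴ) by
      simp only [Matrix.mul_assoc, conjTranspose_mul, conjTranspose_conjTranspose],
      Matrix.trace_mul_comm, hU, hV,
      show E * 1 * Yᴴ * 1 * Y * Vᴴ * V = E * Yᴴ * Y * (Vᴴ * V) by
      simp only [Matrix.mul_assoc, Matrix.one_mul], hV, Matrix.mul_one]
  have f1 : (D * Y * (Uᴴ * V)ᴴ).trace.re =
      ∑ i, ∑ j, a i * (star ((Uᴴ * V) i j) * Y i j).re := by
    simp only [Matrix.trace, diag_apply, Complex.re_sum, D]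
    refine Finset.sum_congr rfl fun i _ => ?_
    rw [Matrix.mul_apply, Complex.re_sum]
    refine Finset.sum_congr rfl fun j _ => ?_
    rw [diagonal_mul, conjTranspose_apply, mul_assoc, Complex.re_ofReal_mul, mul_comm (Y i j)]
  have f2 : (Y * E * (Uᴴ * V)ᴴ).trace.re =
      ∑ i, ∑ j, b j * (star ((Uᴴ * V) i j) * Y i j).re := by
    simp only [Matrix.trace, diag_apply, Complex.re_sum, E]
    refine Finset.sum_congr rfl fun i _ => ?_
    rw [Matrix.mul_apply, Complex.re_sum]
    refine Finset.sum_congr rfl fun j _ => ?_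
    rw [mul_diagonal, conjTranspose_apply, mul_right_comm, mul_comm, Complex.re_ofReal_mul,
      mul_comm (Y i j)]
  have f3 : (D * Y * Yᴴ).trace.re = ∑ i, ∑ j, a i * Complex.normSq (Y i j) := by
    simp only [Matrix.trace, diag_apply, Complex.re_sum, D]
    refine Finset.sum_congr rfl fun i _ => ?_
    rw [Matrix.mul_apply, Complex.re_sum]
    refine Finset.sum_congr rfl fun j _ => ?_
    rw [diagonal_mul, conjTranspose_apply, mul_assoc, Complex.re_ofReal_mul, RCLike.star_def,
      Complex.mul_conj, Complex.ofReal_re]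
  have f4 : (E * Yᴴ * Y).trace.re = ∑ i, ∑ j, b j * Complex.normSq (Y i j) := by
    rw [Finset.sum_comm]
    simp only [Matrix.trace, diag_apply, Complex.re_sum, E]
    refine Finset.sum_congr rfl fun i _ => ?_
    rw [Matrix.mul_apply, Complex.re_sum]
    refine Finset.sum_congr rfl fun j _ => ?_
    rw [diagonal_mul, conjTranspose_apply, mul_assoc, Complex.re_ofReal_mul, RCLike.star_def,
      mul_comm (starRingEnd ℂ _), Complex.mul_conj, Complex.ofReal_re]
  rw [varFun, e1, e2, e3, e4, Complex.sub_re, f1, f2, f3, f4]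
  simp only [Finset.mul_sum, ← Finset.sum_sub_distrib]
  refine Finset.sum_congr rfl fun i _ => Finset.sum_congr rfl fun j _ => ?_
  ring

/-- The quadratic form of two positive semidefinite matrices in their eigenbases. -/
def relQuad {ρ σ : Matrix ι ι ℂ} (hρ : ρ.PosSemidef) (hσ : σ.PosSemidef) (t : ℝ) : ℝ :=
  spectralQuad hρ.1.eigenvalues hσ.1.eigenvalues (overlap hρ.1 hσ.1) t

lemma varFun_le_relQuad {ρ σ : Matrix ι ι ℂ} (hρ : ρ.PosSemidef) (hσ : σ.PosSemidef)
    {t : ℝ} (ht : t ∈ Set.Ioo 0 1) (X : Matrix ι ι ℂ) :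
    varFun t ρ σ X ≤ relQuad hρ hσ t := by
  set U := (hρ.1.eigenvectorUnitary : Matrix ι ι ℂ)
  set V := (hσ.1.eigenvectorUnitary : Matrix ι ι ℂ)
  have hX : X = U * (Uᴴ * X * V) * Vᴴ := by
    rw [show U * (Uᴴ * X * V) * Vᴴ = (U * Uᴴ) * X * (V * Vᴴ) by simp only [Matrix.mul_assoc],
      eigenvectorUnitary_mul_conjTranspose, eigenvectorUnitary_mul_conjTranspose,
      Matrix.one_mul, Matrix.mul_one]
  rw [congrArg₂ (fun x y => varFun t x y X) (isHermitian_eq_diag hρ.1)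
    (isHermitian_eq_diag hσ.1), hX,
    varFun_diag _ _ _ _ (eigenvectorUnitary_conjTranspose_mul hρ.1)
      (eigenvectorUnitary_conjTranspose_mul hσ.1)]
  refine Finset.sum_le_sum fun i _ => Finset.sum_le_sum fun j _ => ?_
  have ha := mul_nonneg ht.1.le (hρ.eigenvalues_nonneg i)
  have hb := mul_nonneg (sub_pos.2 ht.2).le (hσ.eigenvalues_nonneg j)
  refine completed_square_le _ _ (add_nonneg ha hb) fun h => ?_
  have h1 := ((add_eq_zero_iff_of_nonneg ha hb).1 h).1
  have h2 := ((add_eq_zero_iff_of_nonneg ha hb).1 h).2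
  rw [(mul_eq_zero.1 h1).resolve_left ht.1.ne', (mul_eq_zero.1 h2).resolve_left
    (sub_pos.2 ht.2).ne', sub_zero]

lemma exists_varFun_eq_relQuad {ρ σ : Matrix ι ι ℂ} (hρ : ρ.PosSemidef) (hσ : σ.PosSemidef)
    (t : ℝ) : ∃ X, varFun t ρ σ X = relQuad hρ hσ t := by
  set Y : Matrix ι ι ℂ := fun i j =>
    (((hρ.1.eigenvalues i - hσ.1.eigenvalues j) /
      (t * hρ.1.eigenvalues i + (1 - t) * hσ.1.eigenvalues j) : ℝ) : ℂ) *
        overlap hρ.1 hσ.1 i j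
  refine ⟨hρ.1.eigenvectorUnitary * Y * (hσ.1.eigenvectorUnitary : Matrix ι ι ℂ)ᴴ, ?_⟩
  rw [congrArg₂ (fun x y => varFun t x y _) (isHermitian_eq_diag hρ.1)
    (isHermitian_eq_diag hσ.1),
    varFun_diag _ _ _ _ (eigenvectorUnitary_conjTranspose_mul hρ.1)
      (eigenvectorUnitary_conjTranspose_mul hσ.1)]
  exact Finset.sum_congr rfl fun i _ => Finset.sum_congr rfl fun j _ => completed_square_eq _

lemma re_dotProduct_mulVec_eigenvectorBasis {ρ σ : Matrix ι ι ℂ} (hρ : ρ.IsHermitian) (hσ : σ.IsHermitian) (j : ι) :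
    (star (fun i => hσ.eigenvectorBasis j i) ⬝ᵥ
      ρ.mulVec (fun i => hσ.eigenvectorBasis j i)).re =
    ∑ i, hρ.eigenvalues i * Complex.normSq (overlap hρ hσ i j) := by
  set V := (hσ.eigenvectorUnitary : Matrix ι ι ℂ)
  have h1 : star (fun i => hσ.eigenvectorBasis j i) ⬝ᵥ
      ρ.mulVec (fun i => hσ.eigenvectorBasis j i) = (Vᴴ * (ρ * V)) j j := by
    rfl
  have h2 : Vᴴ * (ρ * V) = (overlap hρ hσ)ᴴ * (diagonal (fun i => (hρ.eigenvalues i : ℂ)) *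
      overlap hρ hσ) := by
    conv_lhs => rw [isHermitian_eq_diag hρ]
    simp only [overlap, conjTranspose_mul, conjTranspose_conjTranspose, Matrix.mul_assoc, V]
  rw [h1, h2, Matrix.mul_apply, Complex.re_sum]
  refine Finset.sum_congr rfl fun i _ => ?_
  rw [diagonal_mul, conjTranspose_apply, mul_left_comm, Complex.re_ofReal_mul, RCLike.star_def,
    mul_comm (starRingEnd ℂ _), Complex.mul_conj, Complex.ofReal_re]

lemma trace_re_eq_sum_eigenvalues {ρ : Matrix ι ι ℂ} (h : ρ.IsHermitian) :
    ρ.trace.re = ∑ i, h.eigenvalues i := by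
  rw [h.trace_eq_sum_eigenvalues, Complex.re_sum]
  rfl

lemma relEnt_eq_sum {ρ σ : Matrix ι ι ℂ} (hρ : ρ.PosSemidef) (hσ : σ.PosSemidef)
    (htr : ρ.trace = σ.trace) :
    relEnt ρ σ = ∑ i, ∑ j, Complex.normSq (overlap hρ.1 hσ.1 i j) *
      (hρ.1.eigenvalues i * Real.log (hρ.1.eigenvalues i) -
        hρ.1.eigenvalues i * Real.log (hσ.1.eigenvalues j) -
        hρ.1.eigenvalues i + hσ.1.eigenvalues j) := by
  have hrow := sum_normSq_row (overlap_mul_conjTranspose hρ.1 hσ.1)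
  have hcol := sum_normSq_col (overlap_conjTranspose_mul hρ.1 hσ.1)
  have htr' : ∑ i, hρ.1.eigenvalues i = ∑ i, hσ.1.eigenvalues i := by
    rw [← trace_re_eq_sum_eigenvalues, ← trace_re_eq_sum_eigenvalues, htr]
  rw [relEnt, dif_pos ⟨hρ.1, hσ.1⟩]
  have h2 : ∀ j, (if 0 < hσ.1.eigenvalues j then Real.log (hσ.1.eigenvalues j) *
      (star (fun i => hσ.1.eigenvectorBasis j i) ⬝ᵥ
        ρ.mulVec (fun i => hσ.1.eigenvectorBasis j i)).re else 0) =
      ∑ i, Complex.normSq (overlap hρ.1 hσ.1 i j) *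
        (hρ.1.eigenvalues i * Real.log (hσ.1.eigenvalues j)) := by
    intro j
    rw [re_dotProduct_mulVec_eigenvectorBasis hρ.1 hσ.1, Finset.mul_sum]
    split_ifs with h
    · exact Finset.sum_congr rfl fun i _ => by ring
    · simp [le_antisymm (not_lt.1 h) (hσ.eigenvalues_nonneg j)]
  simp only [mul_add, mul_sub, Finset.sum_add_distrib, Finset.sum_sub_distrib]
  rw [Finset.sum_congr rfl fun j _ => h2 j,
    Finset.sum_comm (f := fun j i => Complex.normSq (overlap hρ.1 hσ.1 i j) *
      (hρ.1.eigenvalues i * Real.log (hσ.1.eigenvalues j))),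
    Finset.sum_comm (f := fun i j => Complex.normSq (overlap hρ.1 hσ.1 i j) *
      hσ.1.eigenvalues j)]
  simp only [← Finset.sum_mul, hrow, hcol, one_mul]
  rw [htr']
  ring

lemma eigenvalues_eq_zero_of_ker_le {ρ σ : Matrix ι ι ℂ} (hρ : ρ.PosSemidef)
    (hσ : σ.PosSemidef) (hker : ∀ v : ι → ℂ, σ.mulVec v = 0 → ρ.mulVec v = 0) {i j : ι}
    (hj : hσ.1.eigenvalues j = 0) :
    Complex.normSq (overlap hρ.1 hσ.1 i j) * hρ.1.eigenvalues i = 0 := by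
  have h1 : ρ.mulVec (hσ.1.eigenvectorBasis j) = 0 :=
    hker _ (by rw [hσ.1.mulVec_eigenvectorBasis, hj, zero_smul])
  have h2 := re_dotProduct_mulVec_eigenvectorBasis hρ.1 hσ.1 j
  rw [h1, dotProduct_zero, Complex.zero_re, eq_comm, Finset.sum_eq_zero_iff_of_nonneg
    fun i _ => mul_nonneg (hρ.eigenvalues_nonneg i) (Complex.normSq_nonneg _)] at h2
  rw [mul_comm]
  exact h2 i (Finset.mem_univ i)

/-- Integral representation of the quantum relative entropy. -/
lemma relEnt_eq_integral {ρ σ : Matrix ι ι ℂ} (hρ : ρ.PosSemidef) (hσ : σ.PosSemidef)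
    (htr : ρ.trace = σ.trace) (hker : ∀ v : ι → ℂ, σ.mulVec v = 0 → ρ.mulVec v = 0) :
    IntervalIntegrable (fun t => (1 - t) * relQuad hρ hσ t) MeasureTheory.volume 0 1 ∧
    relEnt ρ σ = ∫ t in (0 : ℝ)..1, (1 - t) * relQuad hρ hσ t := by
  have key := fun i j => integral_weighted_log_quotient (hρ.eigenvalues_nonneg i)
    (hσ.eigenvalues_nonneg j) (eigenvalues_eq_zero_of_ker_le hρ hσ hker (i := i) (j := j))
  simp only [relQuad, spectralQuad, Finset.mul_sum]
  have hint : ∀ i, IntervalIntegrable (fun t => ∑ j, (1 - t) *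
      (Complex.normSq (overlap hρ.1 hσ.1 i j) *
        ((hρ.1.eigenvalues i - hσ.1.eigenvalues j) ^ 2 /
          (t * hρ.1.eigenvalues i + (1 - t) * hσ.1.eigenvalues j))))
      MeasureTheory.volume 0 1 := fun i => by
    simpa only [Finset.sum_fn] using! IntervalIntegrable.sum Finset.univ fun j _ => (key i j).1
  constructor
  · simpa only [Finset.sum_fn] using! IntervalIntegrable.sum Finset.univ fun i _ => hint i
  · rw [relEnt_eq_sum hρ hσ htr, intervalIntegral.integral_finsetSum fun i _ => hint i]
    refine Finset.sum_congr rfl fun i _ => ?_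
    rw [intervalIntegral.integral_finsetSum fun j _ => (key i j).1]
    exact Finset.sum_congr rfl fun j _ => (key i j).2.symm

end Spectral

section Isometry

open scoped MatrixOrder in
lemma trace_mul_re_nonneg {ι : Type*} [Fintype ι] [DecidableEq ι] {A M : Matrix ι ι ℂ} (hA : A.PosSemidef)
    (hM : M.PosSemidef) : 0 ≤ (A * M).trace.re := by
  classical
  obtain ⟨C, rfl⟩ : ∃ C : Matrix ι ι ℂ, A = Cᴴ * C :=
    CStarAlgebra.nonneg_iff_eq_star_mul_self.1 (Matrix.nonneg_iff_posSemidef.2 hA)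
  rw [Matrix.mul_assoc, Matrix.trace_mul_comm]
  exact (Complex.le_def.1 (hM.mul_mul_conjTranspose_same C).trace_nonneg).1

variable {ι κ : Type*} [Fintype ι] [Fintype κ]

/-- Compression by an isometry can only increase the variational functional. -/
lemma varFun_isometry_le [DecidableEq ι] [DecidableEq κ] {t : ℝ} (ht : t ∈ Set.Ioo 0 1) {ρ σ : Matrix κ κ ℂ}
    (hρ : ρ.PosSemidef) (hσ : σ.PosSemidef) {W : Matrix ι κ ℂ} (hW : Wᴴ * W = 1)
    (X : Matrix ι ι ℂ) :
    varFun t (W * ρ * Wᴴ) (W * σ * Wᴴ) X ≤ varFun t ρ σ (Wᴴ * X * W) := by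
  have hproj : (1 - W * Wᴴ).PosSemidef := by
    have : 1 - W * Wᴴ = (1 - W * Wᴴ)ᴴ * (1 - W * Wᴴ) := by
      have h : W * Wᴴ * (W * Wᴴ) = W * Wᴴ := by
        rw [Matrix.mul_assoc, ← Matrix.mul_assoc Wᴴ, hW, Matrix.one_mul]
      simp [Matrix.sub_mul, Matrix.mul_sub, h]
    rw [this]
    exact posSemidef_conjTranspose_mul_self _
  have lin : ∀ A : Matrix κ κ ℂ, (W * A * Wᴴ * X).trace = (A * (Wᴴ * X * W)).trace := by
    intro A
    rw [show W * A * Wᴴ * X = W * (A * Wᴴ * X) by simp only [Matrix.mul_assoc],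
      Matrix.trace_mul_comm]
    simp only [Matrix.mul_assoc]
  have quad : ∀ (A : Matrix κ κ ℂ) (Z : Matrix ι ι ℂ), A.PosSemidef →
      (A * (Wᴴ * Z * W) * (Wᴴ * Z * W)ᴴ).trace.re ≤ (W * A * Wᴴ * Z * Zᴴ).trace.re := by
    intro A Z hA
    have h1 : (W * A * Wᴴ * Z * Zᴴ).trace = (A * (Wᴴ * Z * Zᴴ * W)).trace := by
      rw [show W * A * Wᴴ * Z * Zᴴ = W * (A * Wᴴ * Z * Zᴴ) by simp only [Matrix.mul_assoc],
        Matrix.trace_mul_comm]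
      simp only [Matrix.mul_assoc]
    have h2 : A * (Wᴴ * Z * Zᴴ * W) - A * (Wᴴ * Z * W) * (Wᴴ * Z * W)ᴴ =
        A * ((Wᴴ * Z) * (1 - W * Wᴴ) * (Wᴴ * Z)ᴴ) := by
      simp only [Matrix.mul_sub, Matrix.sub_mul, conjTranspose_mul, conjTranspose_conjTranspose,
        Matrix.mul_one, Matrix.mul_assoc]
    have h3 : 0 ≤ (A * ((Wᴴ * Z) * (1 - W * Wᴴ) * (Wᴴ * Z)ᴴ)).trace.re :=
      trace_mul_re_nonneg hA (hproj.mul_mul_conjTranspose_same (Wᴴ * Z))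
    rw [← h2, Matrix.trace_sub, Complex.sub_re, ← h1] at h3
    linarith
  have q1 := quad ρ X hρ
  have q2 := quad σ Xᴴ hσ
  have e : (Wᴴ * X * W)ᴴ = Wᴴ * Xᴴ * W := by
    simp only [conjTranspose_mul, conjTranspose_conjTranspose, Matrix.mul_assoc]
  rw [← e, conjTranspose_conjTranspose, conjTranspose_conjTranspose] at q2
  rw [varFun, varFun, lin, lin]
  nlinarith [mul_le_mul_of_nonneg_left q1 ht.1.le,
    mul_le_mul_of_nonneg_left q2 (sub_pos.2 ht.2).le]

lemma varFun_sum {B : Type*} (s : Finset B) (t : ℝ) (c : B → ℝ) (ρ σ : B → Matrix ι ι ℂ)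
    (X : Matrix ι ι ℂ) :
    varFun t (∑ β ∈ s, c β • ρ β) (∑ β ∈ s, c β • σ β) X =
      ∑ β ∈ s, c β * varFun t (ρ β) (σ β) X := by
  simp only [varFun, Finset.sum_mul, Matrix.trace_sum, Matrix.smul_mul, Matrix.trace_smul,
    Complex.sub_re, Complex.re_sum, Complex.smul_re, smul_eq_mul, Finset.mul_sum,
    ← Finset.sum_sub_distrib]
  exact Finset.sum_congr rfl fun _ _ => by ring

end Isometry

section Ensemble

lemma trace_eq_one_smul_sum {ι B : Type*} [Fintype ι] [Fintype B] {q : B → ℝ}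
    (hq1 : ∑ β, q β = 1) {ρ : B → Matrix ι ι ℂ} (hρ : ∀ β, (ρ β).trace = 1) :
    (∑ β, q β • ρ β).trace = 1 := by
  simp only [Matrix.trace_sum, Matrix.trace_smul, hρ]
  rw [← Finset.sum_smul, hq1, one_smul]

lemma posSemidef_smul_sum {ι B : Type*} [Fintype ι] [Fintype B] {q : B → ℝ}
    (hq0 : ∀ β, 0 ≤ q β) {ρ : B → Matrix ι ι ℂ} (hρ : ∀ β, (ρ β).PosSemidef) :
    (∑ β, q β • ρ β).PosSemidef :=
  posSemidef_sum _ fun β _ => (hρ β).smul (hq0 β)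

lemma IsDensityMatrix.convex_sum {ι B : Type*} [Fintype ι] [Fintype B] {q : B → ℝ}
    (hq0 : ∀ β, 0 ≤ q β) (hq1 : ∑ β, q β = 1) {ρ : B → Matrix ι ι ℂ}
    (hρ : ∀ β, IsDensityMatrix (ρ β)) : IsDensityMatrix (∑ β, q β • ρ β) :=
  ⟨posSemidef_smul_sum hq0 fun β => (hρ β).1, trace_eq_one_smul_sum hq1 fun β => (hρ β).2⟩

lemma IsDensityMatrix.kronecker {ι κ : Type*} [Fintype ι] [Fintype κ]
    {ρ : Matrix ι ι ℂ} {σ : Matrix κ κ ℂ} (hρ : IsDensityMatrix ρ) (hσ : IsDensityMatrix σ) :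
    IsDensityMatrix (ρ ⊗ₖ σ) :=
  ⟨hρ.1.kronecker hσ.1, by rw [trace_kronecker, hρ.2, hσ.2, one_mul]⟩

/-- The kernel of a positive combination is contained in the kernel of each summand. -/
lemma mulVec_eq_zero_of_sum {ι B : Type*} [Fintype ι] [Fintype B] {q : B → ℝ}
    (hq0 : ∀ β, 0 ≤ q β) {ρ : B → Matrix ι ι ℂ} (hρ : ∀ β, (ρ β).PosSemidef)
    {v : ι → ℂ} (hv : (∑ β, q β • ρ β).mulVec v = 0) {β : B} (hβ : 0 < q β) :
    (ρ β).mulVec v = 0 := by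
  have h := congrArg (fun w => star v ⬝ᵥ w) hv
  simp only [Matrix.sum_mulVec, dotProduct_sum, dotProduct_zero] at h
  rw [Finset.sum_eq_zero_iff_of_nonneg fun β _ =>
    ((hρ β).smul (hq0 β)).dotProduct_mulVec_nonneg v] at h
  have h1 := h β (Finset.mem_univ β)
  rw [((hρ β).smul (hq0 β)).dotProduct_mulVec_zero_iff, Matrix.smul_mulVec] at h1
  exact (smul_eq_zero.1 h1).resolve_left hβ.ne'

/-- `Φ` is a convex combination of conjugations by isometries. -/
def IsIsometricMixture {ι κ : Type*} [Fintype κ] [DecidableEq κ] [Fintype ι]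
    (Φ : Matrix κ κ ℂ → Matrix ι ι ℂ) : Prop :=
  ∃ (s : ℕ) (r : Fin s → ℝ) (W : Fin s → Matrix ι κ ℂ), (∀ k, 0 ≤ r k) ∧ ∑ k, r k = 1 ∧
    (∀ k, (W k)ᴴ * W k = 1) ∧ ∀ A, Φ A = ∑ k, r k • (W k * A * (W k)ᴴ)

lemma varFun_mixture_le {ι κ : Type*} [Fintype ι] [Fintype κ] [DecidableEq ι] [DecidableEq κ]
    {Φ : Matrix κ κ ℂ → Matrix ι ι ℂ} (hΦ : IsIsometricMixture Φ) {ρ σ : Matrix κ κ ℂ}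
    (hρ : ρ.PosSemidef) (hσ : σ.PosSemidef) {t : ℝ} (ht : t ∈ Set.Ioo 0 1)
    (X : Matrix ι ι ℂ) : varFun t (Φ ρ) (Φ σ) X ≤ relQuad hρ hσ t := by
  obtain ⟨s, r, W, hr0, hr1, hW, hΦ⟩ := hΦ
  rw [hΦ, hΦ, varFun_sum]
  calc _ ≤ ∑ k, r k * relQuad hρ hσ t := Finset.sum_le_sum fun k _ =>
        mul_le_mul_of_nonneg_left ((varFun_isometry_le ht hρ hσ (hW k) X).trans
          (varFun_le_relQuad hρ hσ ht _)) (hr0 k)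
    _ = relQuad hρ hσ t := by rw [← Finset.sum_mul, hr1, one_mul]

/-- Joint convexity and monotonicity of the relative entropy, combined: an ensemble whose
members are processed by isometric mixtures depending on the letter. -/
lemma relEnt_le_holevoChi {ι κ B : Type*} [Fintype ι] [Fintype κ] [DecidableEq ι]
    [DecidableEq κ] [Fintype B] {q : B → ℝ} (hq0 : ∀ β, 0 ≤ q β)
    (hq1 : ∑ β, q β = 1) {ρ : B → Matrix κ κ ℂ} (hρ : ∀ β, IsDensityMatrix (ρ β))
    {Φ : B → Matrix κ κ ℂ → Matrix ι ι ℂ} (hΦ : ∀ β, IsIsometricMixture (Φ β))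
    {γ σ : Matrix ι ι ℂ} (hγ : IsDensityMatrix γ) (hσ : IsDensityMatrix σ)
    (hker : ∀ v : ι → ℂ, σ.mulVec v = 0 → γ.mulVec v = 0)
    (hγsum : γ = ∑ β, q β • Φ β (ρ β)) (hσsum : σ = ∑ β, q β • Φ β (∑ b, q b • ρ b)) :
    relEnt γ σ ≤ holevoChi q ρ := by
  have hbar := IsDensityMatrix.convex_sum hq0 hq1 hρ
  have key : ∀ β, IntervalIntegrable
      (fun t => q β * ((1 - t) * relQuad (hρ β).1 hbar.1 t)) MeasureTheory.volume 0 1 ∧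
      (if 0 < q β then q β * relEnt (ρ β) (∑ b, q b • ρ b) else 0) =
        ∫ t in (0 : ℝ)..1, q β * ((1 - t) * relQuad (hρ β).1 hbar.1 t) := by
    intro β
    split_ifs with h
    · obtain ⟨h1, h2⟩ := relEnt_eq_integral (hρ β).1 hbar.1 ((hρ β).2.trans hbar.2.symm)
        fun v hv => mulVec_eq_zero_of_sum hq0 (fun β => (hρ β).1) hv h
      exact ⟨h1.const_mul _, by rw [intervalIntegral.integral_const_mul, h2]⟩
    · simp [le_antisymm (not_lt.1 h) (hq0 β)]
  obtain ⟨hint, heq⟩ := relEnt_eq_integral hγ.1 hσ.1 (hγ.2.trans hσ.2.symm) hker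
  rw [heq, holevoChi, Finset.sum_congr rfl fun β _ => (key β).2,
    ← intervalIntegral.integral_finsetSum fun β _ => (key β).1]
  refine intervalIntegral.integral_mono_on_of_le_Ioo zero_le_one hint ?_ fun t ht => ?_
  · simpa only [Finset.sum_fn] using! IntervalIntegrable.sum Finset.univ fun β _ => (key β).1
  obtain ⟨X, hX⟩ := exists_varFun_eq_relQuad hγ.1 hσ.1 t
  rw [← hX, congrArg₂ (fun x y => varFun t x y X) hγsum hσsum, varFun_sum, Finset.mul_sum]
  refine Finset.sum_le_sum fun β _ => ?_
  rw [mul_left_comm]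
  exact mul_le_mul_of_nonneg_left (mul_le_mul_of_nonneg_left
    (varFun_mixture_le (hΦ β) (hρ β).1 hbar.1 ht X) (sub_pos.2 ht.2).le) (hq0 β)

lemma sum_eigenvalues_mul {n : ℕ} {ρ : Matrix (Fin n) (Fin n) ℂ} (h : ρ.IsHermitian)
    (i j : Fin n) : ∑ k, (h.eigenvalues k : ℂ) * (h.eigenvectorBasis k i *
      star (h.eigenvectorBasis k j)) = ρ i j := by
  conv_rhs => rw [isHermitian_eq_diag h]
  rw [Matrix.mul_apply]
  refine Finset.sum_congr rfl fun k _ => ?_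
  rw [mul_diagonal, conjTranspose_apply, h.eigenvectorUnitary_apply,
    h.eigenvectorUnitary_apply]
  ring

lemma sum_star_eigenvectorBasis_mul {n : ℕ} {ρ : Matrix (Fin n) (Fin n) ℂ}
    (h : ρ.IsHermitian) (k : Fin n) :
    ∑ i, star (h.eigenvectorBasis k i) * h.eigenvectorBasis k i = 1 := by
  have := congrFun (congrFun (eigenvectorUnitary_conjTranspose_mul h) k) k
  rw [Matrix.mul_apply, one_apply_eq] at this
  exact this

lemma sum_eigenvalues_eq_one {n : ℕ} {ρ : Matrix (Fin n) (Fin n) ℂ} (h : IsDensityMatrix ρ) :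
    ∑ k, h.1.1.eigenvalues k = 1 := by
  rw [← trace_re_eq_sum_eigenvalues, h.2, Complex.one_re]

lemma isIsometricMixture_kronecker_right {n m : ℕ} {F : Matrix (Fin m) (Fin m) ℂ}
    (hF : IsDensityMatrix F) :
    IsIsometricMixture (fun E : Matrix (Fin n) (Fin n) ℂ => E ⊗ₖ F) := by
  refine ⟨m, hF.1.1.eigenvalues, fun k => Matrix.of fun x i =>
    if x.1 = i then hF.1.1.eigenvectorBasis k x.2 else 0, hF.1.eigenvalues_nonneg,
    sum_eigenvalues_eq_one hF, fun k => ?_, fun A => ?_⟩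
  · ext i i'
    have := sum_star_eigenvectorBasis_mul hF.1.1 k
    simp only [Matrix.mul_apply, conjTranspose_apply, of_apply, Fintype.sum_prod_type,
      apply_ite star, star_zero, ite_mul, zero_mul, mul_ite, mul_zero, Matrix.one_apply]
    by_cases h : i = i'
    · subst h
      simpa using this
    · simp [h, Ne.symm h]
  · ext x y
    change A x.1 y.1 * F x.2 y.2 = _
    rw [← sum_eigenvalues_mul hF.1.1, Matrix.sum_apply, Finset.mul_sum]
    refine Finset.sum_congr rfl fun k _ => ?_
    simp only [Matrix.smul_apply, Matrix.mul_apply, conjTranspose_apply, of_apply,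
      apply_ite star, star_zero, ite_mul, zero_mul, mul_ite, mul_zero, Finset.sum_ite_eq,
      Finset.mem_univ, if_true, Complex.real_smul]
    ring

lemma isIsometricMixture_kronecker_left {n m : ℕ} {E : Matrix (Fin n) (Fin n) ℂ}
    (hE : IsDensityMatrix E) :
    IsIsometricMixture (fun F : Matrix (Fin m) (Fin m) ℂ => E ⊗ₖ F) := by
  refine ⟨n, hE.1.1.eigenvalues, fun k => Matrix.of fun x j =>
    if x.2 = j then hE.1.1.eigenvectorBasis k x.1 else 0, hE.1.eigenvalues_nonneg,
    sum_eigenvalues_eq_one hE, fun k => ?_, fun A => ?_⟩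
  · ext i i'
    have := sum_star_eigenvectorBasis_mul hE.1.1 k
    simp only [Matrix.mul_apply, conjTranspose_apply, of_apply, Fintype.sum_prod_type,
      apply_ite star, star_zero, ite_mul, zero_mul, mul_ite, mul_zero, Matrix.one_apply]
    by_cases h : i = i'
    · subst h
      simpa using this
    · simp [h, Ne.symm h]
  · ext x y
    change E x.1 y.1 * A x.2 y.2 = _
    rw [← sum_eigenvalues_mul hE.1.1, Matrix.sum_apply, Finset.sum_mul]
    refine Finset.sum_congr rfl fun k _ => ?_
    simp only [Matrix.smul_apply, Matrix.mul_apply, conjTranspose_apply, of_apply,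
      apply_ite star, star_zero, ite_mul, zero_mul, mul_ite, mul_zero, Finset.sum_ite_eq,
      Finset.mem_univ, if_true, Complex.real_smul]
    ring

lemma kronecker_smul_sum {ι κ B : Type*} [Fintype B] (q : B → ℝ) (E : Matrix ι ι ℂ)
    (F : B → Matrix κ κ ℂ) : E ⊗ₖ (∑ β, q β • F β) = ∑ β, q β • (E ⊗ₖ F β) := by
  ext x y
  simp only [kroneckerMap_apply, Matrix.sum_apply, Matrix.smul_apply, Finset.mul_sum,
    mul_smul_comm]

lemma smul_sum_kronecker {ι κ B : Type*} [Fintype B] (q : B → ℝ) (E : B → Matrix ι ι ℂ)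
    (F : Matrix κ κ ℂ) : (∑ β, q β • E β) ⊗ₖ F = ∑ β, q β • (E β ⊗ₖ F) := by
  ext x y
  simp only [kroneckerMap_apply, Matrix.sum_apply, Matrix.smul_apply, Finset.sum_mul,
    smul_mul_assoc]

lemma mulVec_kronecker_sum_eq_zero {ι κ B : Type*} [Fintype ι] [Fintype κ] [Fintype B]
    {q : B → ℝ} (hq0 : ∀ β, 0 ≤ q β) {E : B → Matrix ι ι ℂ} {F : B → Matrix κ κ ℂ}
    (hE : ∀ β, (E β).PosSemidef) (hF : ∀ β, (F β).PosSemidef) {v : ι × κ → ℂ}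
    (hv : ((∑ β, q β • E β) ⊗ₖ (∑ β, q β • F β)).mulVec v = 0) :
    (∑ β, q β • (E β ⊗ₖ F β)).mulVec v = 0 := by
  rw [Matrix.sum_mulVec]
  refine Finset.sum_eq_zero fun β _ => ?_
  rcases (hq0 β).eq_or_lt with h | h
  · rw [← h, zero_smul, Matrix.zero_mulVec]
  rw [smul_sum_kronecker] at hv
  have h1 := mulVec_eq_zero_of_sum hq0
    (fun β => (hE β).kronecker (posSemidef_smul_sum hq0 hF)) hv h
  rw [kronecker_smul_sum] at h1
  rw [Matrix.smul_mulVec, mulVec_eq_zero_of_sum hq0 (fun b => (hE β).kronecker (hF b)) h1 h,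
    smul_zero]

lemma relEnt_kronecker_le_holevoChi_left
    {n m : ℕ} {B : Type*} [Fintype B] {q : B → ℝ} (hq0 : ∀ β, 0 ≤ q β)
    (hq1 : ∑ β, q β = 1) {E : B → Matrix (Fin n) (Fin n) ℂ}
    {F : B → Matrix (Fin m) (Fin m) ℂ} (hE : ∀ β, IsDensityMatrix (E β))
    (hF : ∀ β, IsDensityMatrix (F β)) :
    relEnt (∑ β, q β • (E β ⊗ₖ F β)) ((∑ β, q β • E β) ⊗ₖ (∑ β, q β • F β)) ≤
      holevoChi q E :=
  relEnt_le_holevoChi hq0 hq1 hE (fun β => isIsometricMixture_kronecker_right (hF β))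
    (IsDensityMatrix.convex_sum hq0 hq1 fun β => (hE β).kronecker (hF β))
    ((IsDensityMatrix.convex_sum hq0 hq1 hE).kronecker
      (IsDensityMatrix.convex_sum hq0 hq1 hF))
    (fun _ => mulVec_kronecker_sum_eq_zero hq0 (fun β => (hE β).1) fun β => (hF β).1)
    rfl (kronecker_smul_sum _ _ _)

lemma relEnt_kronecker_le_holevoChi_right
    {n m : ℕ} {B : Type*} [Fintype B] {q : B → ℝ} (hq0 : ∀ β, 0 ≤ q β)
    (hq1 : ∑ β, q β = 1) {E : B → Matrix (Fin n) (Fin n) ℂ}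
    {F : B → Matrix (Fin m) (Fin m) ℂ} (hE : ∀ β, IsDensityMatrix (E β))
    (hF : ∀ β, IsDensityMatrix (F β)) :
    relEnt (∑ β, q β • (E β ⊗ₖ F β)) ((∑ β, q β • E β) ⊗ₖ (∑ β, q β • F β)) ≤
      holevoChi q F :=
  relEnt_le_holevoChi hq0 hq1 hF (fun β => isIsometricMixture_kronecker_left (hE β))
    (IsDensityMatrix.convex_sum hq0 hq1 fun β => (hE β).kronecker (hF β))
    ((IsDensityMatrix.convex_sum hq0 hq1 hE).kronecker
      (IsDensityMatrix.convex_sum hq0 hq1 hF))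
    (fun _ => mulVec_kronecker_sum_eq_zero hq0 (fun β => (hE β).1) fun β => (hF β).1)
    rfl (smul_sum_kronecker _ _ _)

lemma holevoChi_congr {ι B : Type*} [Fintype ι] [DecidableEq ι] [Fintype B] {q : B → ℝ}
    (hq0 : ∀ β, 0 ≤ q β) {τ τ' : B → Matrix ι ι ℂ} (h : ∀ β, 0 < q β → τ β = τ' β) :
    holevoChi q τ = holevoChi q τ' := by
  have hbar : ∑ β, q β • τ β = ∑ β, q β • τ' β := Finset.sum_congr rfl fun β _ => by
    rcases (hq0 β).eq_or_lt with h0 | h0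
    · rw [← h0, zero_smul, zero_smul]
    · rw [h β h0]
  rw [holevoChi, holevoChi, hbar]
  refine Finset.sum_congr rfl fun β _ => ?_
  split_ifs with h0
  · rw [h β h0]
  · rfl

end Ensemble

section Instrument

variable {n m : ℕ} {Ω K : Type*} [Fintype K]

lemma instAct_posSemidef (V : Ω → K → Matrix (Fin m) (Fin n) ℂ)
    {ρ : Matrix (Fin n) (Fin n) ℂ} (hρ : ρ.PosSemidef) (ω : Ω) :
    (instAct V ω ρ).PosSemidef :=
  posSemidef_sum _ fun k _ => hρ.mul_mul_conjTranspose_same (V ω k)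

lemma trace_instAct (V : Ω → K → Matrix (Fin m) (Fin n) ℂ) (ρ : Matrix (Fin n) (Fin n) ℂ)
    (ω : Ω) : (instAct V ω ρ).trace = (povm V ω * ρ).trace := by
  rw [instAct, povm, Finset.sum_mul, Matrix.trace_sum, Matrix.trace_sum]
  refine Finset.sum_congr rfl fun k _ => ?_
  rw [Matrix.trace_mul_comm, Matrix.mul_assoc]

lemma probOut_eq_trace (V : Ω → K → Matrix (Fin m) (Fin n) ℂ)
    (ρ : Matrix (Fin n) (Fin n) ℂ) (ω : Ω) :
    probOut V ρ ω = (instAct V ω ρ).trace.re := by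
  rw [trace_instAct, probOut]

lemma ofReal_probOut (V : Ω → K → Matrix (Fin m) (Fin n) ℂ)
    {ρ : Matrix (Fin n) (Fin n) ℂ} (hρ : ρ.PosSemidef) (ω : Ω) :
    (probOut V ρ ω : ℂ) = (instAct V ω ρ).trace := by
  rw [probOut_eq_trace]
  exact Complex.ext rfl (Complex.le_def.1 (instAct_posSemidef V hρ ω).trace_nonneg).2

lemma probOut_nonneg (V : Ω → K → Matrix (Fin m) (Fin n) ℂ)
    {ρ : Matrix (Fin n) (Fin n) ℂ} (hρ : ρ.PosSemidef) (ω : Ω) : 0 ≤ probOut V ρ ω := by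
  rw [probOut_eq_trace]
  exact (Complex.le_def.1 (instAct_posSemidef V hρ ω).trace_nonneg).1

lemma probOut_smul_sum {A : Type*} [Fintype A] (V : Ω → K → Matrix (Fin m) (Fin n) ℂ)
    (p : A → ℝ) (ρ : A → Matrix (Fin n) (Fin n) ℂ) (ω : Ω) :
    probOut V (∑ α, p α • ρ α) ω = ∑ α, p α * probOut V (ρ α) ω := by
  simp only [probOut, Matrix.mul_sum, Matrix.mul_smul, Matrix.trace_sum, Matrix.trace_smul,
    Complex.re_sum, Complex.smul_re, smul_eq_mul]

lemma trace_sum_instAct [Fintype Ω] {V : Ω → K → Matrix (Fin m) (Fin n) ℂ}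
    (hV : ∑ ω, ∑ k, (V ω k)ᴴ * V ω k = 1) (ρ : Matrix (Fin n) (Fin n) ℂ) :
    (∑ ω, instAct V ω ρ).trace = ρ.trace := by
  simp only [Matrix.trace_sum, trace_instAct]
  rw [← Matrix.trace_sum, ← Finset.sum_mul]
  simp only [povm, hV, Matrix.one_mul]

lemma isDensityMatrix_sum_instAct [Fintype Ω] {V : Ω → K → Matrix (Fin m) (Fin n) ℂ}
    (hV : ∑ ω, ∑ k, (V ω k)ᴴ * V ω k = 1) {ρ : Matrix (Fin n) (Fin n) ℂ}
    (hρ : IsDensityMatrix ρ) : IsDensityMatrix (∑ ω, instAct V ω ρ) :=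
  ⟨posSemidef_sum _ fun ω _ => instAct_posSemidef V hρ.1 ω,
    (trace_sum_instAct hV ρ).trans hρ.2⟩

lemma sum_probOut [Fintype Ω] {V : Ω → K → Matrix (Fin m) (Fin n) ℂ}
    (hV : ∑ ω, ∑ k, (V ω k)ᴴ * V ω k = 1) {ρ : Matrix (Fin n) (Fin n) ℂ}
    (hρ : IsDensityMatrix ρ) : ∑ ω, probOut V ρ ω = 1 := by
  simp only [probOut_eq_trace]
  rw [← Complex.re_sum, ← Matrix.trace_sum, trace_sum_instAct hV, hρ.2, Complex.one_re]

lemma instAct_eq_zero {V : Ω → K → Matrix (Fin m) (Fin n) ℂ} {ρ : Matrix (Fin n) (Fin n) ℂ}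
    (hρ : ρ.PosSemidef) {ω : Ω} (h : probOut V ρ ω = 0) : instAct V ω ρ = 0 := by
  rw [← (instAct_posSemidef V hρ ω).trace_eq_zero_iff, ← ofReal_probOut V hρ, h,
    Complex.ofReal_zero]

lemma isDensityMatrix_post {V : Ω → K → Matrix (Fin m) (Fin n) ℂ}
    {ρ : Matrix (Fin n) (Fin n) ℂ} (hρ : ρ.PosSemidef) {ω : Ω} (h : 0 < probOut V ρ ω) :
    IsDensityMatrix (post V ω ρ) := by
  rw [post, ← probOut_eq_trace]
  refine ⟨(instAct_posSemidef V hρ ω).smul (inv_nonneg.2 h.le), ?_⟩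
  rw [Matrix.trace_smul, ← ofReal_probOut V hρ, Complex.real_smul, ← Complex.ofReal_mul,
    inv_mul_cancel₀ h.ne', Complex.ofReal_one]

end Instrument

theorem common_lower_bound_compound_chis {A Ω K : Type*} [Fintype A] [Fintype Ω] [Fintype K]
    [Nonempty A] [Nonempty Ω] [Nonempty K] {n m : ℕ} (hn : 1 ≤ n) (hm : 1 ≤ m)
    (p : A → ℝ) (hp0 : ∀ α, 0 ≤ p α) (hp1 : ∑ α, p α = 1)
    (ρ : A → Matrix (Fin n) (Fin n) ℂ) (hρ : ∀ α, IsDensityMatrix (ρ α))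
    (V : Ω → K → Matrix (Fin m) (Fin n) ℂ)
    (hV : ∑ ω, ∑ k, (V ω k)ᴴ * V ω k = 1)
    (η : Matrix (Fin n) (Fin n) ℂ) (hη : η = ∑ α, p α • ρ α)
    (Pf : Ω → ℝ) (hPf : ∀ ω, Pf ω = probOut V η ω)
    (ηf : Matrix (Fin m) (Fin m) ℂ) (hηf : ηf = ∑ ω, instAct V ω η)
    (εi : Ω → Matrix (Fin n) (Fin n) ℂ)
    (hεi : ∀ ω, 0 < Pf ω → εi ω =
      ∑ α, if 0 < p α * probOut V (ρ α) ω then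
        ((p α * probOut V (ρ α) ω) / Pf ω) • ρ α else 0)
    (τf : A → Matrix (Fin m) (Fin m) ℂ)
    (hτf : ∀ α, 0 < p α → τf α =
      ∑ ω, if 0 < Pf ω then probOut V (ρ α) ω • post V ω η else 0)
    (γif : Matrix (Fin n × Fin m) (Fin n × Fin m) ℂ)
    (hγif : γif = ∑ ω, if 0 < Pf ω then Pf ω • (εi ω ⊗ₖ post V ω η) else 0) :
    IsDensityMatrix γif ∧
    (∀ v : Fin n × Fin m → ℂ, (η ⊗ₖ ηf).mulVec v = 0 → γif.mulVec v = 0) ∧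
    holevoChi Pf εi ≥ relEnt γif (η ⊗ₖ ηf) ∧
    holevoChi p τf ≥ relEnt γif (η ⊗ₖ ηf) := by
  have hP0 : ∀ α ω, 0 ≤ probOut V (ρ α) ω := fun α ω => probOut_nonneg V (hρ α).1 ω
  have hP1 : ∀ α, ∑ ω, probOut V (ρ α) ω = 1 := fun α => sum_probOut hV (hρ α)
  have hηd : IsDensityMatrix η := hη ▸ IsDensityMatrix.convex_sum hp0 hp1 hρ
  have hPf0 : ∀ ω, 0 ≤ Pf ω := fun ω => hPf ω ▸ probOut_nonneg V hηd.1 ω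
  have hPf1 : ∑ ω, Pf ω = 1 := by
    rw [Finset.sum_congr rfl fun ω _ => hPf ω, sum_probOut hV hηd]
  have hPfsum : ∀ ω, Pf ω = ∑ α, p α * probOut V (ρ α) ω := fun ω => by
    rw [hPf, hη, probOut_smul_sum]
  have hzero : ∀ α ω, ¬ 0 < Pf ω → p α * probOut V (ρ α) ω = 0 := fun α ω h => by
    have h0 := le_antisymm (not_lt.1 h) (hPf0 ω)
    rw [hPfsum, Finset.sum_eq_zero_iff_of_nonneg fun α _ => mul_nonneg (hp0 α) (hP0 α ω)] at h0
    exact h0 α (Finset.mem_univ α)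
  have hηfd : IsDensityMatrix ηf := hηf ▸ isDensityMatrix_sum_instAct hV hηd
  set E : Ω → Matrix (Fin n) (Fin n) ℂ := fun ω => if 0 < Pf ω then εi ω else η with hE
  set F : Ω → Matrix (Fin m) (Fin m) ℂ := fun ω => if 0 < Pf ω then post V ω η else ηf with hF
  have hε : ∀ ω, 0 < Pf ω → εi ω = ∑ α, (p α * probOut V (ρ α) ω / Pf ω) • ρ α := by
    intro ω h
    rw [hεi ω h]
    refine Finset.sum_congr rfl fun α _ => ?_
    split_ifs with h'
    · rfl
    · rw [le_antisymm (not_lt.1 h') (mul_nonneg (hp0 α) (hP0 α ω)), zero_div, zero_smul]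
  have hEd : ∀ ω, IsDensityMatrix (E ω) := by
    intro ω
    simp only [hE]
    split_ifs with h
    · rw [hε ω h]
      refine IsDensityMatrix.convex_sum
        (fun α => div_nonneg (mul_nonneg (hp0 α) (hP0 α ω)) h.le) ?_ hρ
      rw [← Finset.sum_div, ← hPfsum, div_self h.ne']
    · exact hηd
  have hFd : ∀ ω, IsDensityMatrix (F ω) := by
    intro ω
    simp only [hF]
    split_ifs with h
    · exact isDensityMatrix_post hηd.1 (hPf ω ▸ h)
    · exact hηfd
  have hPE : ∀ ω, Pf ω • E ω = ∑ α, (p α * probOut V (ρ α) ω) • ρ α := by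
    intro ω
    simp only [hE]
    split_ifs with h
    · rw [hε ω h, Finset.smul_sum]
      exact Finset.sum_congr rfl fun α _ => by rw [smul_smul, mul_div_cancel₀ _ h.ne']
    · rw [le_antisymm (not_lt.1 h) (hPf0 ω), zero_smul,
        Finset.sum_eq_zero fun α _ => by rw [hzero α ω h, zero_smul]]
  have hPF : ∀ ω, Pf ω • F ω = instAct V ω η := by
    intro ω
    simp only [hF]
    split_ifs with h
    · rw [post, smul_smul, ← probOut_eq_trace, ← hPf, mul_inv_cancel₀ h.ne', one_smul]
    · rw [instAct_eq_zero hηd.1 (by rw [← hPf]; exact le_antisymm (not_lt.1 h) (hPf0 ω)),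
        le_antisymm (not_lt.1 h) (hPf0 ω), zero_smul]
  have hηE : η = ∑ ω, Pf ω • E ω := by
    simp only [hPE]
    rw [Finset.sum_comm, hη]
    refine Finset.sum_congr rfl fun α _ => ?_
    rw [← Finset.sum_smul, ← Finset.mul_sum, hP1, mul_one]
  have hηF : ηf = ∑ ω, Pf ω • F ω := by simp only [hPF, hηf]
  have hγE : γif = ∑ ω, Pf ω • (E ω ⊗ₖ F ω) := by
    rw [hγif]
    refine Finset.sum_congr rfl fun ω _ => ?_
    simp only [hE, hF]
    split_ifs with h
    · rfl
    · rw [le_antisymm (not_lt.1 h) (hPf0 ω), zero_smul]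
  set T : A → Matrix (Fin m) (Fin m) ℂ := fun α => ∑ ω, probOut V (ρ α) ω • F ω with hT
  have hTd : ∀ α, IsDensityMatrix (T α) := fun α =>
    IsDensityMatrix.convex_sum (hP0 α) (hP1 α) hFd
  have hτT : ∀ α, 0 < p α → τf α = T α := by
    intro α h
    rw [hτf α h]
    refine Finset.sum_congr rfl fun ω _ => ?_
    simp only [hF]
    split_ifs with h'
    · rfl
    · rw [(mul_eq_zero.1 (hzero α ω h')).resolve_left h.ne', zero_smul]
  have hηT : ηf = ∑ α, p α • T α := by
    simp only [hηF, hT, Finset.smul_sum, smul_smul]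
    rw [Finset.sum_comm]
    exact Finset.sum_congr rfl fun ω _ => by rw [← Finset.sum_smul, ← hPfsum]
  have hγT : γif = ∑ α, p α • (ρ α ⊗ₖ T α) := by
    have h1 : ∀ ω, Pf ω • (E ω ⊗ₖ F ω) =
        ∑ α, (p α * probOut V (ρ α) ω) • (ρ α ⊗ₖ F ω) := fun ω => by
      rw [← smul_kronecker, hPE, smul_sum_kronecker]
    simp only [hγE, h1, hT, kronecker_smul_sum, Finset.smul_sum, smul_smul]
    exact Finset.sum_comm
  refine ⟨?_, fun v hv => ?_, ?_, ?_⟩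
  · rw [hγE]
    exact IsDensityMatrix.convex_sum hPf0 hPf1 fun ω => (hEd ω).kronecker (hFd ω)
  · rw [hηE, hηF] at hv
    rw [hγE]
    exact mulVec_kronecker_sum_eq_zero hPf0 (fun ω => (hEd ω).1) (fun ω => (hFd ω).1) hv
  · rw [holevoChi_congr hPf0 (τ' := E) fun ω h => by simp only [hE, if_pos h], hγE,
      congrArg₂ (fun x y => x ⊗ₖ y) hηE hηF]
    exact relEnt_kronecker_le_holevoChi_left hPf0 hPf1 hEd hFd
  · rw [holevoChi_congr hp0 hτT, hγT, congrArg₂ (fun x y => x ⊗ₖ y) hη hηT]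
    exact relEnt_kronecker_le_holevoChi_right hp0 hp1 hρ hTd

end
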